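/- arXiv:1604.06228 — 3 statements merged into one kernel-verified Lean document; each statement's English description precedes it below -/
import Mathlib

section
/- Let N ≥ 4 be an integer and let t ≥ N−1. Let p_1, …, p_t be points of the complex projective space ℙ^{N−2} = ℙ(ℂ^{N−1}) in linearly general position, with chosen representative vectors v_1, …, v_t ∈ ℂ^{N−1} ∖ {0}. Then the points impose at least min{t, 2N−5} independent conditions on quadrics; that is, the linear evaluation map from the space of homogeneous polynomials of degree 2 in N−1 variables over ℂ to ℂ^t, sending q to (q(v_1), …, q(v_t)), has rank at least min{t, 2N−5}. -/
open MvPolynomial in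
/-- A linear functional on `σ → R` is evaluation of a homogeneous polynomial of degree `1`. -/
theorem exists_isHomogeneous_one_aeval_eq {σ R : Type*} [Fintype σ] [CommSemiring R]
    (f : (σ → R) →ₗ[R] R) :
    ∃ p : MvPolynomial σ R, p.IsHomogeneous 1 ∧ ∀ x : σ → R, aeval x p = f x := by
  classical
  refine ⟨∑ k, C (f (Pi.single k 1)) * X k, ?_, fun x => ?_⟩
  · exact IsHomogeneous.sum _ _ _ fun k _ => by
      simpa using (isHomogeneous_C σ (f (Pi.single k 1))).mul (isHomogeneous_X R k)
  · rw [LinearMap.pi_apply_eq_sum_univ f x]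
    simp only [map_sum, map_mul, algHom_C, aeval_X, Algebra.algebraMap_self, RingHom.id_apply,
      smul_eq_mul]
    refine Finset.sum_congr rfl fun k _ => ?_
    rw [mul_comm]
    congr 2
    ext j
    simp [Pi.single_apply, eq_comm]

/-- If the vectors indexed by `insert i S` are linearly independent, some linear form vanishes
on those indexed by `S` but not on the one indexed by `i`. -/
theorem exists_linearForm_separating {ι σ K : Type*} [DecidableEq ι] [Fintype σ] [Field K]
    (v : ι → σ → K) {S : Finset ι} {i : ι} (hi : i ∉ S)
    (h : LinearIndependent K (fun j : (insert i S : Finset ι) => v j.1)) :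
    ∃ p : MvPolynomial σ K, p.IsHomogeneous 1 ∧ (∀ j ∈ S, MvPolynomial.aeval (v j) p = 0) ∧
      MvPolynomial.aeval (v i) p ≠ 0 := by
  have hmem : v i ∉ Submodule.span K (v '' (S : Set ι)) := by
    have h' : LinearIndepOn K v (insert i (S : Set ι)) := by
      rw [← Finset.coe_insert]
      exact h
    exact ((linearIndepOn_insert (by simpa using hi)).1 h').2
  obtain ⟨f, hfi, hf⟩ := Submodule.exists_le_ker_of_notMem hmem
  obtain ⟨p, hp, hpf⟩ := exists_isHomogeneous_one_aeval_eq f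
  refine ⟨p, hp, fun j hj => ?_, by rwa [hpf]⟩
  rw [hpf]
  exact hf (Submodule.subset_span ⟨j, hj, rfl⟩)

/-- For vectors in linearly general position and `T` of size at most `2 (n - 1)`, some quadric
passes through the points of `T` but not through a given further point. -/
theorem exists_quadric_separating {ι σ K : Type*} [DecidableEq ι] [Fintype σ] [Field K]
    (v : ι → σ → K) {n : ℕ}
    (hgen : ∀ S : Finset ι, S.card ≤ n → LinearIndependent K (fun i : S => v i.1)) (hn : 1 ≤ n)
    {T : Finset ι} (hT : T.card ≤ 2 * (n - 1)) {i : ι} (hi : i ∉ T) :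
    ∃ p : MvPolynomial σ K, p.IsHomogeneous 2 ∧ (∀ j ∈ T, MvPolynomial.aeval (v j) p = 0) ∧
      MvPolynomial.aeval (v i) p ≠ 0 := by
  obtain ⟨A, hAT, hA⟩ := Finset.exists_subset_card_eq (min_le_right (n - 1) T.card)
  have hB : (T \ A).card ≤ n - 1 := by
    rw [Finset.card_sdiff_of_subset hAT]
    omega
  have key : ∀ S ⊆ T, S.card ≤ n - 1 → ∃ p : MvPolynomial σ K, p.IsHomogeneous 1 ∧
      (∀ j ∈ S, MvPolynomial.aeval (v j) p = 0) ∧ MvPolynomial.aeval (v i) p ≠ 0 := by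
    intro S hS hc
    refine exists_linearForm_separating v (fun h => hi (hS h)) (hgen _ ?_)
    have := Finset.card_insert_le i S
    omega
  obtain ⟨p, hp, hpA, hpi⟩ := key A hAT (by omega)
  obtain ⟨q, hq, hqB, hqi⟩ := key (T \ A) Finset.sdiff_subset hB
  refine ⟨p * q, hp.mul hq, fun j hj => ?_, by simpa using ⟨hpi, hqi⟩⟩
  by_cases hjA : j ∈ A
  · rw [map_mul, hpA j hjA, zero_mul]
  · rw [map_mul, hqB j (Finset.mem_sdiff.2 ⟨hj, hjA⟩), mul_zero]

/-- A family of vectors that is diagonal with nonzero entries on the coordinates selected by `e`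
is linearly independent. -/
theorem linearIndependent_of_diagonal {κ ι K : Type*} [Field K] (e : κ → ι) (w : κ → ι → K)
    (hne : ∀ a, w a (e a) ≠ 0) (hzero : ∀ a b, a ≠ b → w a (e b) = 0) :
    LinearIndependent K w := by
  rw [linearIndependent_iff']
  intro s g hg a ha
  have h := congrFun hg (e a)
  rw [Finset.sum_apply, Finset.sum_eq_single_of_mem a ha
    (fun b _ hb => by simp [hzero b a hb])] at h
  simpa [hne a] using h


/-- **Castelnuovo's lemma.** Let `N ≥ 4`, `t ≥ N - 1`, and let `v 1, …, v t` be nonzero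
vectors of `ℂ^(N-1)` representing points of `ℙ^(N-2) = ℙ(ℂ^(N-1))` in linearly general
position (every subset of at most `N - 1` of the representative vectors is linearly
independent).  Then the points impose at least `min t (2N - 5)` independent conditions on
quadrics: the evaluation map from the space of homogeneous polynomials of degree `2` in
`N - 1` variables to `ℂ^t`, `q ↦ (q (v 1), …, q (v t))`, has rank at least
`min t (2N - 5)`. -/
theorem castelnuovo_conditions_on_quadrics
    (N t : ℕ) (hN : 4 ≤ N) (ht : N - 1 ≤ t)
    (v : Fin t → (Fin (N - 1) → ℂ)) (hv : ∀ i, v i ≠ 0)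
    (hgen : ∀ S : Finset (Fin t), S.card ≤ N - 1 →
      LinearIndependent ℂ (fun i : S => v i.1)) :
    ((min t (2 * N - 5) : ℕ) : Cardinal) ≤
      LinearMap.rank
        (LinearMap.pi (fun i : Fin t =>
          (MvPolynomial.aeval (v i)).toLinearMap ∘ₗ
            (MvPolynomial.homogeneousSubmodule (Fin (N - 1)) ℂ 2).subtype)) := by
  classical
  set m := min t (2 * N - 5)
  let e : Fin m ↪ Fin t := Fin.castLEEmb (min_le_left _ _)
  have hquad (a : Fin m) := exists_quadric_separating v hgen (by omega)
    (T := (Finset.univ.erase a).map e) (i := e a)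
    (by simp only [Finset.card_map, Finset.card_erase_of_mem (Finset.mem_univ a),
          Finset.card_univ, Fintype.card_fin]
        omega)
    (by simp)
  choose p hp hzero hne using hquad
  set L := LinearMap.pi (fun i : Fin t =>
    (MvPolynomial.aeval (v i)).toLinearMap ∘ₗ
      (MvPolynomial.homogeneousSubmodule (Fin (N - 1)) ℂ 2).subtype)
  let q (a : Fin m) : MvPolynomial.homogeneousSubmodule (Fin (N - 1)) ℂ 2 := ⟨p a, hp a⟩
  have hli : LinearIndependent ℂ (fun a => L (q a)) :=
    linearIndependent_of_diagonal e _ hne fun a b hab =>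
      hzero a (e b) (Finset.mem_map_of_mem e (by simpa using hab.symm))
  have hli' : LinearIndependent ℂ (fun a => L.rangeRestrict (q a)) :=
    LinearIndependent.of_comp L.range.subtype hli
  simpa using hli'.cardinal_lift_le_rank
end

section
/- Let d ≥ 1 and fix a primitive d-th root of unity ζ ∈ ℂ. Let H_d be the (finite Heisenberg-type) group whose underlying set is ℂ* × (ℤ/dℤ) × (ℤ/dℤ) with multiplication (α, a, b)·(α′, a′, b′) = (α α′ ζ^{b a′}, a + a′, b + b′), so that ℂ* is central and H_d is a central extension of (ℤ/dℤ)² by ℂ*. Then every finite-dimensional irreducible complex representation of H_d of weight 1 (i.e., on which each central element α ∈ ℂ* acts as multiplication by the scalar α) has dimension d, and any two such irreducible representations are isomorphic. -/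
/-- The underlying set of the Heisenberg group of a `(1,d)`-polarized abelian surface:
`ℂ* × (ℤ/dℤ) × (ℤ/dℤ)`. -/
structure Heis (d : ℕ) : Type where
  c : ℂˣ
  a : ZMod d
  b : ZMod d

/-- Multiplication `(α, a, b) * (α', a', b') = (α * α' * ζ ^ (b * a'), a + a', b + b')`. -/
def heisMul (d : ℕ) (ζ : ℂˣ) (x y : Heis d) : Heis d :=
  ⟨x.c * y.c * ζ ^ (x.b * y.a).val, x.a + y.a, x.b + y.b⟩

def heisOne (d : ℕ) : Heis d := ⟨1, 0, 0⟩

def heisInv (d : ℕ) (ζ : ℂˣ) (x : Heis d) : Heis d :=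
  ⟨(x.c * ζ ^ ((-x.b) * x.a).val)⁻¹, -x.a, -x.b⟩

theorem heis_pow_val_add (d : ℕ) [NeZero d] (ζ : ℂˣ) (hζ : ζ ^ d = 1) (x y : ZMod d) :
    ζ ^ (x + y).val = ζ ^ x.val * ζ ^ y.val := by
  rw [← pow_add, ZMod.val_add]
  conv_rhs => rw [← Nat.mod_add_div (x.val + y.val) d, pow_add, pow_mul, hζ, one_pow, mul_one]

/-- The Heisenberg group structure on `ℂ* × (ℤ/dℤ) × (ℤ/dℤ)` attached to a `d`-th root of
unity `ζ`.  The subgroup `ℂ*` of elements `(α, 0, 0)` is central and the group is a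
central extension of `(ℤ/dℤ)²` by `ℂ*`. -/
def heisGroup (d : ℕ) (hd : d ≠ 0) (ζ : ℂˣ) (hζ : ζ ^ d = 1) : Group (Heis d) := by
  haveI : NeZero d := ⟨hd⟩
  have key : ∀ x y : ZMod d, ζ ^ (x + y).val = ζ ^ x.val * ζ ^ y.val :=
    heis_pow_val_add d ζ hζ
  refine
    { mul := heisMul d ζ
      one := heisOne d
      inv := heisInv d ζ
      mul_assoc := ?_
      one_mul := ?_
      mul_one := ?_
      inv_mul_cancel := ?_ }
  · rintro ⟨xc, xa, xb⟩ ⟨yc, ya, yb⟩ ⟨zc, za, zb⟩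
    show heisMul d ζ (heisMul d ζ ⟨xc, xa, xb⟩ ⟨yc, ya, yb⟩) ⟨zc, za, zb⟩ =
      heisMul d ζ ⟨xc, xa, xb⟩ (heisMul d ζ ⟨yc, ya, yb⟩ ⟨zc, za, zb⟩)
    have h2 : xb * ya + (xb + yb) * za = yb * za + xb * (ya + za) := by ring
    simp only [heisMul, Heis.mk.injEq]
    refine ⟨?_, add_assoc _ _ _, add_assoc _ _ _⟩
    calc xc * yc * ζ ^ (xb * ya).val * zc * ζ ^ ((xb + yb) * za).val
        = xc * yc * zc * (ζ ^ (xb * ya).val * ζ ^ ((xb + yb) * za).val) := by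
          simp [mul_comm, mul_left_comm, mul_assoc]
      _ = xc * yc * zc * ζ ^ (xb * ya + (xb + yb) * za).val := by rw [key]
      _ = xc * yc * zc * ζ ^ (yb * za + xb * (ya + za)).val := by rw [h2]
      _ = xc * yc * zc * (ζ ^ (yb * za).val * ζ ^ (xb * (ya + za)).val) := by rw [key]
      _ = xc * (yc * zc * ζ ^ (yb * za).val) * ζ ^ (xb * (ya + za)).val := by
          simp [mul_comm, mul_left_comm, mul_assoc]
  · rintro ⟨xc, xa, xb⟩
    show heisMul d ζ (heisOne d) ⟨xc, xa, xb⟩ = ⟨xc, xa, xb⟩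
    simp [heisMul, heisOne]
  · rintro ⟨xc, xa, xb⟩
    show heisMul d ζ ⟨xc, xa, xb⟩ (heisOne d) = ⟨xc, xa, xb⟩
    simp [heisMul, heisOne]
  · rintro ⟨xc, xa, xb⟩
    show heisMul d ζ (heisInv d ζ ⟨xc, xa, xb⟩) ⟨xc, xa, xb⟩ = heisOne d
    simp only [heisMul, heisInv, heisOne, Heis.mk.injEq]
    refine ⟨?_, neg_add_cancel _, neg_add_cancel _⟩
    group

/-- A representation of the Heisenberg group has weight `k` if every central element
`(α, 0, 0)`, `α ∈ ℂ*`, acts as multiplication by the scalar `α ^ k`. -/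
def HeisWeight {d : ℕ} [Monoid (Heis d)] (k : ℕ) {V : Type*} [AddCommGroup V]
    [Module ℂ V] (ρ : Representation ℂ (Heis d) V) : Prop :=
  ∀ α : ℂˣ, ρ ⟨α, 0, 0⟩ = ((α : ℂ) ^ k) • (LinearMap.id : V →ₗ[ℂ] V)

/-- A representation is irreducible if the space is nonzero and the only invariant
subspaces are `⊥` and `⊤`. -/
def RepIrreducible {G V : Type*} [Monoid G] [AddCommGroup V] [Module ℂ V]
    (ρ : Representation ℂ G V) : Prop :=
  Nontrivial V ∧
    ∀ W : Submodule ℂ V, (∀ g : G, ∀ w ∈ W, ρ g w ∈ W) → W = ⊥ ∨ W = ⊤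

/-- Two representations are isomorphic if there is an equivariant linear isomorphism. -/
def RepIso {G V W : Type*} [Monoid G] [AddCommGroup V] [Module ℂ V]
    [AddCommGroup W] [Module ℂ W]
    (ρ : Representation ℂ G V) (σ : Representation ℂ G W) : Prop :=
  ∃ e : V ≃ₗ[ℂ] W, ∀ (g : G) (v : V), e (ρ g v) = σ g (e v)

theorem HeisWeight.apply_one {d : ℕ} [Monoid (Heis d)] {k : ℕ} {V : Type*} [AddCommGroup V]
    [Module ℂ V] {ρ : Representation ℂ (Heis d) V} (hρ : HeisWeight k ρ) :
    ρ ⟨1, 0, 0⟩ = LinearMap.id := by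
  rw [hρ 1, Units.val_one, one_pow, one_smul]

/-- Every element acts in a weight-one representation through its scalar and the lifts of
`(a, 0)` and `(0, b)`. -/
theorem heisWeight_one_apply {d : ℕ} [Monoid (Heis d)] {ζ : ℂˣ}
    (hmul : ∀ x y : Heis d, x * y = heisMul d ζ x y)
    {V : Type*} [AddCommGroup V] [Module ℂ V] {ρ : Representation ℂ (Heis d) V}
    (hρ : HeisWeight 1 ρ) (c : ℂˣ) (a b : ZMod d) (v : V) :
    ρ ⟨c, a, b⟩ v = (c : ℂ) • ρ ⟨1, a, 0⟩ (ρ ⟨1, 0, b⟩ v) := by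
  have h : (⟨c, a, b⟩ : Heis d) = ⟨c, 0, 0⟩ * (⟨1, a, 0⟩ * ⟨1, 0, b⟩) := by
    simp [hmul, heisMul]
  rw [h, map_mul, map_mul, hρ c]
  simp

/-- The commutation relation in a weight-one representation. -/
theorem heisWeight_one_apply_shift {d : ℕ} [Monoid (Heis d)] {ζ : ℂˣ}
    (hmul : ∀ x y : Heis d, x * y = heisMul d ζ x y)
    {V : Type*} [AddCommGroup V] [Module ℂ V] {ρ : Representation ℂ (Heis d) V}
    (hρ : HeisWeight 1 ρ) (g : Heis d) (x : ZMod d) (v : V) :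
    ρ g (ρ ⟨1, x, 0⟩ v) =
      ((g.c : ℂ) * (ζ : ℂ) ^ (g.b * x).val) • ρ ⟨1, g.a + x, 0⟩ (ρ ⟨1, 0, g.b⟩ v) := by
  rw [← Module.End.mul_apply, ← map_mul, hmul]
  simp only [heisMul, mul_one, add_zero]
  rw [heisWeight_one_apply hmul hρ]
  push_cast
  rfl

/-- In a weight-one representation, the lift of `(0, n)` acts as the `n`-th power of the lift
of `(0, 1)`. -/
theorem heisWeight_one_apply_natCast {d : ℕ} [Monoid (Heis d)] {ζ : ℂˣ}
    (hmul : ∀ x y : Heis d, x * y = heisMul d ζ x y)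
    {V : Type*} [AddCommGroup V] [Module ℂ V] {ρ : Representation ℂ (Heis d) V}
    (hρ : HeisWeight 1 ρ) (n : ℕ) :
    ρ ⟨1, 0, (n : ZMod d)⟩ = ρ ⟨1, 0, 1⟩ ^ n := by
  induction n with
  | zero =>
    rw [Nat.cast_zero, pow_zero, hρ.apply_one]
    rfl
  | succ n ih =>
    rw [pow_succ, ← ih, ← map_mul, hmul]
    simp [heisMul]

/-- A nonzero weight-one representation contains a nonzero vector fixed by every lift of
`(0, b)`. -/
theorem exists_ne_zero_heisWeight_one_fixed {d : ℕ} [NeZero d] [Monoid (Heis d)] {ζ : ℂˣ}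
    (hprim : IsPrimitiveRoot (ζ : ℂ) d)
    (hmul : ∀ x y : Heis d, x * y = heisMul d ζ x y)
    {V : Type*} [AddCommGroup V] [Module ℂ V] [FiniteDimensional ℂ V] [Nontrivial V]
    {ρ : Representation ℂ (Heis d) V} (hρ : HeisWeight 1 ρ) :
    ∃ v : V, v ≠ 0 ∧ ∀ b : ZMod d, ρ ⟨1, 0, b⟩ v = v := by
  have hinj : ∀ x : ZMod d, ∀ v : V, ρ ⟨1, x, 0⟩ v = 0 → v = 0 := by
    intro x v hv
    have h := heisWeight_one_apply_shift hmul hρ ⟨1, -x, 0⟩ x v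
    simpa [hv, hρ.apply_one] using h.symm
  obtain ⟨μ, hμ⟩ := Module.End.exists_eigenvalue (ρ ⟨1, 0, 1⟩)
  obtain ⟨u, hu⟩ := hμ.exists_hasEigenvector
  have hμd : μ ^ d = 1 := by
    have h := hu.pow_apply d
    rw [← heisWeight_one_apply_natCast hmul hρ, ZMod.natCast_self] at h
    rw [hρ.apply_one, LinearMap.id_apply] at h
    exact smul_left_injective ℂ hu.2 (by simpa using h.symm)
  obtain ⟨k, -, rfl⟩ := hprim.eq_pow_of_pow_eq_one hμd
  have hcancel : (ζ : ℂ) ^ (-(k : ZMod d)).val * (ζ : ℂ) ^ k = 1 := by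
    rw [← pow_add, hprim.pow_eq_one_iff_dvd, ← ZMod.natCast_eq_zero_iff]
    simp
  have hfix : ρ ⟨1, 0, 1⟩ (ρ ⟨1, -(k : ZMod d), 0⟩ u) = ρ ⟨1, -(k : ZMod d), 0⟩ u := by
    rw [heisWeight_one_apply_shift hmul hρ, hu.apply_eq_smul, map_smul, smul_smul]
    simp [hcancel]
  refine ⟨ρ ⟨1, -(k : ZMod d), 0⟩ u, fun h => hu.2 (hinj _ _ h), fun b => ?_⟩
  rw [← ZMod.natCast_zmod_val b, heisWeight_one_apply_natCast hmul hρ]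
  generalize b.val = n
  induction n with
  | zero => simp
  | succ n ih => rw [pow_succ, Module.End.mul_apply, hfix, ih]

/-- An irreducible weight-one representation has a basis on which the Heisenberg group acts by
the formulas of the Schrödinger representation. -/
theorem exists_schrodinger_basis {d : ℕ} [NeZero d] [Monoid (Heis d)] {ζ : ℂˣ}
    (hprim : IsPrimitiveRoot (ζ : ℂ) d)
    (hmul : ∀ x y : Heis d, x * y = heisMul d ζ x y)
    {V : Type*} [AddCommGroup V] [Module ℂ V] [FiniteDimensional ℂ V]
    {ρ : Representation ℂ (Heis d) V} (hρ : HeisWeight 1 ρ) (hirr : RepIrreducible ρ) :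
    ∃ B : Module.Basis (ZMod d) ℂ V, ∀ (g : Heis d) (x : ZMod d),
      ρ g (B x) = ((g.c : ℂ) * (ζ : ℂ) ^ (g.b * x).val) • B (g.a + x) := by
  have := hirr.1
  obtain ⟨v, hv0, hv⟩ := exists_ne_zero_heisWeight_one_fixed hprim hmul hρ
  set e : ZMod d → V := fun x => ρ ⟨1, x, 0⟩ v with he
  have hact : ∀ (g : Heis d) (x : ZMod d),
      ρ g (e x) = ((g.c : ℂ) * (ζ : ℂ) ^ (g.b * x).val) • e (g.a + x) := by
    intro g x
    simp only [he]
    rw [heisWeight_one_apply_shift hmul hρ, hv]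
  have he0 : e 0 = v := hv 0
  have hne : ∀ x, e x ≠ 0 := by
    intro x hx
    have h := hact ⟨1, -x, 0⟩ x
    rw [hx] at h
    exact hv0 (by simpa [he0] using h.symm)
  have hli : LinearIndependent ℂ e := by
    refine Module.End.eigenvectors_linearIndependent' (ρ ⟨1, 0, 1⟩)
      (fun x : ZMod d => (ζ : ℂ) ^ x.val) ?_ e fun x => ?_
    · intro x y hxy
      exact ZMod.val_injective d (hprim.pow_inj x.val_lt y.val_lt hxy)
    · rw [Module.End.hasEigenvector_iff, Module.End.mem_eigenspace_iff]
      exact ⟨by simpa using hact ⟨1, 0, 1⟩ x, hne x⟩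
  have hspan : Submodule.span ℂ (Set.range e) = ⊤ := by
    refine (hirr.2 _ fun g w hw => ?_).resolve_left fun h => ?_
    · induction hw using Submodule.span_induction with
      | mem w hw =>
        obtain ⟨x, rfl⟩ := hw
        rw [hact]
        exact Submodule.smul_mem _ _ (Submodule.subset_span ⟨_, rfl⟩)
      | zero => simp
      | add y z _ _ hy hz => rw [map_add]; exact Submodule.add_mem _ hy hz
      | smul c y _ hy => rw [map_smul]; exact Submodule.smul_mem _ _ hy
    · have h0 : e 0 ∈ Submodule.span ℂ (Set.range e) := Submodule.subset_span ⟨0, rfl⟩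
      rw [h, Submodule.mem_bot] at h0
      exact hne 0 h0
  refine ⟨Module.Basis.mk hli hspan.ge, fun g x => ?_⟩
  simpa using hact g x

/-- **Mumford's theorem.**  Every finite-dimensional irreducible complex representation of
weight `1` of the Heisenberg group `H_d` has dimension `d`, and any two such irreducible
representations are isomorphic. -/
theorem heisenberg_weight_one_irreducible
    (d : ℕ) (hd : 1 ≤ d) (ζ : ℂˣ) (hprim : IsPrimitiveRoot (ζ : ℂ) d) :
    letI : Group (Heis d) :=
      heisGroup d (by omega) ζ (Units.ext (by push_cast; exact hprim.pow_eq_one))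
    (∀ (V : Type) [AddCommGroup V] [Module ℂ V] [FiniteDimensional ℂ V]
        (ρ : Representation ℂ (Heis d) V),
        HeisWeight 1 ρ → RepIrreducible ρ → Module.finrank ℂ V = d) ∧
    (∀ (V W : Type) [AddCommGroup V] [Module ℂ V] [FiniteDimensional ℂ V]
        [AddCommGroup W] [Module ℂ W] [FiniteDimensional ℂ W]
        (ρ : Representation ℂ (Heis d) V) (σ : Representation ℂ (Heis d) W),
        HeisWeight 1 ρ → RepIrreducible ρ →
        HeisWeight 1 σ → RepIrreducible σ → RepIso ρ σ) := by
  have : NeZero d := ⟨by omega⟩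
  let _ : Group (Heis d) :=
    heisGroup d (by omega) ζ (Units.ext (by push_cast; exact hprim.pow_eq_one))
  have hmul : ∀ x y : Heis d, x * y = heisMul d ζ x y := fun _ _ => rfl
  refine ⟨?_, ?_⟩
  · intro V _ _ _ ρ hρ hirr
    obtain ⟨B, -⟩ := exists_schrodinger_basis hprim hmul hρ hirr
    rw [Module.finrank_eq_card_basis B, ZMod.card]
  · intro V W _ _ _ _ _ _ ρ σ hρ hirr hσ hirr'
    obtain ⟨B, hB⟩ := exists_schrodinger_basis hprim hmul hρ hirr
    obtain ⟨C, hC⟩ := exists_schrodinger_basis hprim hmul hσ hirr'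
    let e : V ≃ₗ[ℂ] W := B.equiv C (Equiv.refl _)
    refine ⟨e, fun g v => ?_⟩
    have h : e.toLinearMap ∘ₗ ρ g = σ g ∘ₗ e.toLinearMap :=
      B.ext fun x => by simp [e, hB, hC]
    exact LinearMap.congr_fun h v
end

section
/- Let d ≥ 1 and fix a primitive d-th root of unity ζ ∈ ℂ, and let H_d be the group with underlying set ℂ* × (ℤ/dℤ) × (ℤ/dℤ) and multiplication (α, a, b)·(α′, a′, b′) = (α α′ ζ^{b a′}, a + a′, b + b′). Suppose that d is odd with d ≥ 7, or that d is even with d ≥ 14. Then every finite-dimensional complex representation U of H_d of weight 2 (i.e., on which each central element α ∈ ℂ* acts as multiplication by α²) with dim_ℂ U ≤ 6 is the zero representation. -/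
/-- If two invertible endomorphisms commute up to a scalar `ω`, then `ω` is a root of unity of
order dividing the dimension. -/
theorem pow_finrank_eq_one_of_mul_eq_smul_mul {K V : Type*} [Field K] [AddCommGroup V]
    [Module K V] {f g : Module.End K V} (hf : IsUnit f) (hg : IsUnit g) {ω : K}
    (h : f * g = ω • (g * f)) : ω ^ Module.finrank K V = 1 := by
  have hdet := congrArg LinearMap.det h
  rw [LinearMap.det_smul, map_mul, map_mul, mul_comm (LinearMap.det g)] at hdet
  have hunit : LinearMap.det f * LinearMap.det g ≠ 0 :=
    ((hf.map LinearMap.det).mul (hg.map LinearMap.det)).ne_zero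
  exact mul_right_cancel₀ hunit (by rw [one_mul, ← hdet])

/-- The representation-theoretic step in Lazarsfeld's proof of projective normality of
`(1,d)`-polarized abelian surfaces: if `d` is odd with `d ≥ 7`, or `d` is even with
`d ≥ 14`, then every finite-dimensional complex representation of the Heisenberg group
`H_d` of weight `2` and of dimension at most `6` is the zero representation. -/
theorem heisenberg_weight_two_small_dim_zero
    (d : ℕ) (ζ : ℂˣ) (hprim : IsPrimitiveRoot (ζ : ℂ) d)
    (hd : (Odd d ∧ 7 ≤ d) ∨ (Even d ∧ 14 ≤ d)) :
    letI : Group (Heis d) :=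
      heisGroup d (by rcases hd with ⟨_, h⟩ | ⟨_, h⟩ <;> omega) ζ
        (Units.ext (by push_cast; exact hprim.pow_eq_one))
    ∀ (U : Type) [AddCommGroup U] [Module ℂ U] [FiniteDimensional ℂ U]
      (ρ : Representation ℂ (Heis d) U),
      HeisWeight 2 ρ → Module.finrank ℂ U ≤ 6 → Subsingleton U := by
  intro U _ _ _ ρ hρ hdim
  let _ : Group (Heis d) := heisGroup d (by omega) ζ
    (Units.ext (by push_cast; exact hprim.pow_eq_one))
  have : Fact (1 < d) := ⟨by omega⟩
  have hcomm : (⟨1, 0, 1⟩ : Heis d) * ⟨1, 1, 0⟩ = ⟨ζ, 0, 0⟩ * (⟨1, 1, 0⟩ * ⟨1, 0, 1⟩) := by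
    change heisMul d ζ _ _ = heisMul d ζ _ (heisMul d ζ _ _)
    simp [heisMul, ZMod.val_one]
  have hrho : ρ ⟨1, 0, 1⟩ * ρ ⟨1, 1, 0⟩ =
      ((ζ : ℂ) ^ 2) • (ρ ⟨1, 1, 0⟩ * ρ ⟨1, 0, 1⟩) := by
    rw [← map_mul, hcomm, map_mul, map_mul, hρ ζ, smul_mul_assoc]
    rfl
  have hpow := pow_finrank_eq_one_of_mul_eq_smul_mul
    ((Group.isUnit _).map ρ) ((Group.isUnit _).map ρ) hrho
  rw [← pow_mul] at hpow
  have hdvd := hprim.dvd_of_pow_eq_one _ hpow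
  refine (Module.finrank_zero_iff (R := ℂ)).mp ?_
  rcases hd with ⟨hodd, h⟩ | ⟨_, h⟩
  · exact Nat.eq_zero_of_dvd_of_lt (hodd.coprime_two_right.dvd_of_dvd_mul_left hdvd) (by omega)
  · have := Nat.eq_zero_of_dvd_of_lt hdvd (by omega)
    omega
end
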